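/- arXiv:2503.19500 — 2 statements merged into one kernel-verified Lean document; each statement's English description precedes it below -/
import Mathlib

section
/- Let (h, e, f) be an sl2-triple in a finite-dimensional complex semisimple Lie algebra 𝔤, and let 𝔤₁ denote the eigenspace of ad h with eigenvalue 1. Then the bilinear form B(x, y) = κ(f, [x, y]) on 𝔤₁, where κ is the Killing form of 𝔤, is alternating and nondegenerate (i.e., it is a symplectic form on 𝔤₁). -/
open LieModule Module in
lemma aux_nilp {L : Type*} [LieRing L] [LieAlgebra ℂ L] [Module.Finite ℂ L]
    {h e f : L} (t : IsSl2Triple h e f) {m : L} {μ : ℂ} (hm : ⁅h, m⁆ = μ • m) :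
    ∃ k : ℕ, ((toEnd ℂ L L e) ^ k) m = 0 := by
  by_contra! contra
  let evals (n : ℕ) : ℂ := μ + 2 * (n : ℂ)
  have h_inj : Function.Injective evals := fun a b hab ↦ by
    simpa [evals, add_right_inj, mul_eq_mul_left_iff, Nat.cast_inj] using hab
  have aux (ν : Set.range evals) : (toEnd ℂ L L h).HasEigenvector ν
      (((toEnd ℂ L L e) ^ ν.property.choose) m) := by
    refine ⟨?_, contra _⟩
    rw [Module.End.mem_eigenspace_iff, toEnd_apply_apply, t.lie_h_pow_toEnd_e hm]
    congr 1
    exact ν.property.choose_spec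
  have _i := ((toEnd ℂ L L h).eigenvectors_linearIndependent (Set.range evals) _ aux).finite
  exact (Set.infinite_range_of_injective h_inj) (Set.toFinite _)

open LieModule Module in
/-- On a positive weight space, `e f` is injective. -/
lemma aux_inj {L : Type*} [LieRing L] [LieAlgebra ℂ L] [Module.Finite ℂ L]
    {h e f : L} (t : IsSl2Triple h e f) {x : L} {n : ℕ} (hx : ⁅h, x⁆ = ((n : ℂ) + 2) • x)
    (h0 : ⁅e, ⁅f, x⁆⁆ = 0) : x = 0 := by
  have key (k : ℕ) : ⁅f, ((toEnd ℂ L L e) ^ (k + 1)) x⁆ =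
      (-(((k : ℂ) + 1) * (n + 2 + k))) • ((toEnd ℂ L L e) ^ k) x := by
    have step (y : L) : ⁅f, ⁅e, y⁆⁆ = ⁅e, ⁅f, y⁆⁆ - ⁅h, y⁆ := by
      rw [leibniz_lie e f y, t.lie_e_f]; abel
    induction k with
    | zero =>
      simp only [zero_add, pow_one, pow_zero, toEnd_apply_apply, Module.End.one_apply]
      rw [step, h0, hx]
      module
    | succ k ih =>
      rw [pow_succ', Module.End.mul_apply, toEnd_apply_apply, step, ih,
        t.lie_h_pow_toEnd_e hx, lie_smul, IsSl2Triple.lie_e_pow_toEnd_e]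
      push_cast
      module
  obtain ⟨k, hk⟩ := aux_nilp t hx
  induction k with
  | zero => simpa using hk
  | succ k ih =>
    apply ih
    have := key k
    rw [hk, lie_zero, eq_comm, smul_eq_zero] at this
    refine this.resolve_left ?_
    rw [neg_eq_zero]
    norm_cast
    have : 0 < (k + 1) * (n + 2 + k) := by positivity
    omega

open LieModule Module in
lemma aux_prim {L : Type*} [LieRing L] [LieAlgebra ℂ L] [Module.Finite ℂ L]
    {h e f : L} (t : IsSl2Triple h e f) {a u : L} {n : ℕ} (ha : ⁅h, a⁆ = (n : ℂ) • a + u)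
    (hu : ⁅h, u⁆ = (n : ℂ) • u) (ea : ⁅e, a⁆ = 0) (eu : ⁅e, u⁆ = 0) : u = 0 := by
  by_contra hne
  have P : t.HasPrimitiveVectorWith u (n : ℂ) := ⟨hne, hu, eu⟩
  have hn := P.pow_toEnd_f_ne_zero_of_eq_nat rfl le_rfl
  have hn1 := P.pow_toEnd_f_eq_zero_of_eq_nat rfl
  have hbig (k : ℕ) (hk : n + 1 ≤ k) : ((toEnd ℂ L L f) ^ k) u = 0 := by
    obtain ⟨j, rfl⟩ := Nat.exists_eq_add_of_le hk
    rw [add_comm, pow_add, Module.End.mul_apply, hn1, map_zero]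
  have hw (k : ℕ) : ⁅h, ((toEnd ℂ L L f) ^ k) a⁆ =
      ((n : ℂ) - 2 * k) • ((toEnd ℂ L L f) ^ k) a + ((toEnd ℂ L L f) ^ k) u := by
    induction k with
    | zero => simpa using ha
    | succ k ih =>
      simp only [pow_succ', Module.End.mul_apply, toEnd_apply_apply]
      rw [leibniz_lie h, t.lie_lie_smul_f ℂ, ih, lie_add, lie_smul, neg_lie, smul_lie]
      push_cast
      module
  have he (k : ℕ) : ⁅e, ((toEnd ℂ L L f) ^ (k + 1)) a⁆ =
      (((k : ℂ) + 1) * (n - k)) • ((toEnd ℂ L L f) ^ k) a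
        + ((k : ℂ) + 1) • ((toEnd ℂ L L f) ^ k) u := by
    induction k with
    | zero =>
      simp only [zero_add, pow_one, pow_zero, toEnd_apply_apply, Module.End.one_apply]
      rw [leibniz_lie e, t.lie_e_f, ea, ha, lie_zero]
      push_cast
      module
    | succ k ih =>
      rw [pow_succ', Module.End.mul_apply, toEnd_apply_apply, leibniz_lie e, t.lie_e_f, hw, ih,
        lie_add, lie_smul, lie_smul, IsSl2Triple.lie_e_pow_toEnd_e, IsSl2Triple.lie_e_pow_toEnd_e]
      push_cast
      module
  have hb : ⁅-h, ((toEnd ℂ L L f) ^ (n + 1)) a⁆ =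
      ((n : ℂ) + 2) • ((toEnd ℂ L L f) ^ (n + 1)) a := by
    rw [neg_lie, hw, hn1]
    push_cast
    module
  obtain ⟨k, hk⟩ := aux_nilp t.symm hb
  rw [← Module.End.mul_apply, ← pow_add] at hk
  have hz : ((toEnd ℂ L L f) ^ (n + 1)) a = 0 := by
    induction k with
    | zero => simpa using hk
    | succ k ih =>
      apply ih
      have h1 := he (k + (n + 1))
      rw [show k + (n + 1) + 1 = k + 1 + (n + 1) by ring, hk, lie_zero, hbig _ (by omega),
        smul_zero, add_zero, eq_comm, smul_eq_zero] at h1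
      refine h1.resolve_left (mul_ne_zero (by norm_cast) ?_)
      rw [sub_ne_zero]
      norm_cast
      omega
  have h1 := he n
  rw [hz, lie_zero, sub_self, mul_zero, zero_smul, zero_add, eq_comm, smul_eq_zero] at h1
  exact hn (h1.resolve_left (by norm_cast))

open LieModule Module in
/-- `h` is semisimple on nonnegative integral weights. -/
lemma aux_ss {L : Type*} [LieRing L] [LieAlgebra ℂ L] [Module.Finite ℂ L]
    {h e f : L} (t : IsSl2Triple h e f) (n : ℕ) (v u : L) (hv : ⁅h, v⁆ = (n : ℂ) • v + u)
    (hu : ⁅h, u⁆ = (n : ℂ) • u) : u = 0 := by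
  have hfin : {n : ℕ | (toEnd ℂ L L h).HasEigenvalue (n : ℂ)}.Finite :=
    (Module.End.finite_hasEigenvalue (toEnd ℂ L L h)).preimage
      (Nat.cast_injective.injOn)
  obtain ⟨N, hN⟩ := hfin.bddAbove
  obtain ⟨d, hd⟩ : ∃ d : ℕ, N < n + 2 * d := ⟨N + 1, by omega⟩
  induction d generalizing n v u with
  | zero =>
    by_contra hne
    have : (toEnd ℂ L L h).HasEigenvalue (n : ℂ) :=
      Module.End.hasEigenvalue_of_hasEigenvector
        (x := u) ⟨by rw [Module.End.mem_eigenspace_iff]; exact hu, hne⟩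
    have := hN this
    omega
  | succ d ih =>
    have hev : ⁅h, ⁅e, v⁆⁆ = ((n + 2 : ℕ) : ℂ) • ⁅e, v⁆ + ⁅e, u⁆ := by
      rw [leibniz_lie h, t.lie_h_e_smul ℂ, hv, lie_add, lie_smul, smul_lie]
      push_cast
      module
    have heu : ⁅h, ⁅e, u⁆⁆ = ((n + 2 : ℕ) : ℂ) • ⁅e, u⁆ := by
      rw [leibniz_lie h, t.lie_h_e_smul ℂ, hu, lie_smul, smul_lie]
      push_cast
      module
    have eu := ih (n + 2) _ _ hev heu (by omega)
    rw [eu, add_zero] at hev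
    let W := Module.End.eigenspace (toEnd ℂ L L h) ((n + 2 : ℕ) : ℂ)
    have hf {z : L} (hz : ⁅h, z⁆ = ((n + 2 : ℕ) : ℂ) • z) : ⁅h, ⁅f, z⁆⁆ = (n : ℂ) • ⁅f, z⁆ := by
      rw [leibniz_lie h, t.lie_lie_smul_f ℂ, hz, lie_smul, neg_lie, smul_lie]
      push_cast
      module
    have hmem (z : L) (hz : z ∈ W) : (toEnd ℂ L L e ∘ₗ toEnd ℂ L L f) z ∈ W := by
      simp only [W, Module.End.mem_eigenspace_iff, toEnd_apply_apply, LinearMap.comp_apply] at hz ⊢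
      rw [leibniz_lie h, t.lie_h_e_smul ℂ, hf hz, lie_smul, smul_lie]
      push_cast
      module
    let T : W →ₗ[ℂ] W := (toEnd ℂ L L e ∘ₗ toEnd ℂ L L f).restrict hmem
    have hT : Function.Injective T := by
      rw [← LinearMap.ker_eq_bot, LinearMap.ker_eq_bot']
      rintro ⟨z, hz⟩ h0
      have h0' : ⁅e, ⁅f, z⁆⁆ = 0 := congrArg Subtype.val h0
      have hz' : ⁅h, z⁆ = ((n + 2 : ℕ) : ℂ) • z := Module.End.mem_eigenspace_iff.mp hz
      push_cast at hz'
      exact Subtype.ext (aux_inj t hz' h0')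
    obtain ⟨⟨z, hz⟩, hzz⟩ := LinearMap.surjective_of_injective hT
      ⟨⁅e, v⁆, Module.End.mem_eigenspace_iff.mpr hev⟩
    have hzz' : ⁅e, ⁅f, z⁆⁆ = ⁅e, v⁆ := congrArg Subtype.val hzz
    have hz' : ⁅h, z⁆ = ((n + 2 : ℕ) : ℂ) • z := Module.End.mem_eigenspace_iff.mp hz
    refine aux_prim t (a := v - ⁅f, z⁆) ?_ hu ?_ eu
    · rw [lie_sub, hv, hf hz']
      module
    · rw [lie_sub, hzz', sub_self]

/-- For an `sl₂`-triple `(h, e, f)` in a finite-dimensional complex semisimple Lie algebra `𝔤`,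
the bilinear form `B(x, y) = κ(f, ⁅x, y⁆)` on the eigenspace `𝔤₁` of `ad h` with eigenvalue `1`
is alternating and nondegenerate, i.e. it is a symplectic form on `𝔤₁`. -/
theorem killing_form_bracket_symplectic_on_weight_one_space
    (L : Type*) [LieRing L] [LieAlgebra ℂ L] [Module.Finite ℂ L]
    [LieAlgebra.IsSemisimple ℂ L]
    (h e f : L) (ht : IsSl2Triple h e f) :
    (∀ x : Module.End.eigenspace (LieAlgebra.ad ℂ L h) (1 : ℂ),
        killingForm ℂ L f ⁅(x : L), (x : L)⁆ = 0) ∧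
    (∀ x : Module.End.eigenspace (LieAlgebra.ad ℂ L h) (1 : ℂ),
        (∀ y : Module.End.eigenspace (LieAlgebra.ad ℂ L h) (1 : ℂ),
          killingForm ℂ L f ⁅(x : L), (y : L)⁆ = 0) → x = 0) := by
  refine ⟨fun x ↦ by simp, ?_⟩
  rintro ⟨x, hx⟩ hxy
  have hx' : ⁅h, x⁆ = (1 : ℂ) • x := Module.End.mem_eigenspace_iff.mp hx
  have hfx : ⁅h, ⁅f, x⁆⁆ = -⁅f, x⁆ := by
    rw [leibniz_lie h, ht.lie_lie_smul_f ℂ, hx', lie_smul, neg_lie, smul_lie]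
    module
  set T : L →ₗ[ℂ] L := LieAlgebra.ad ℂ L h - (1 : ℂ) • LinearMap.id with hTdef
  have hTa (v : L) : T v = ⁅h, v⁆ - v := by simp [hTdef]
  have hdisj : Disjoint (LinearMap.ker T) (LinearMap.range T) := by
    rw [Submodule.disjoint_def]
    rintro u hu ⟨v, hv⟩
    rw [LinearMap.mem_ker, hTa, sub_eq_zero] at hu
    rw [hTa] at hv
    refine aux_ss ht 1 v u ?_ ?_
    · rw [← hv]; simp
    · rw [hu]; simp
  have htop : LinearMap.ker T ⊔ LinearMap.range T = ⊤ := by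
    apply Submodule.eq_top_of_disjoint _ _ _ hdisj
    rw [add_comm, LinearMap.finrank_range_add_finrank_ker]
  have hz : ⁅f, x⁆ = 0 := by
    have hker : ⁅f, x⁆ ∈ LinearMap.ker (killingForm ℂ L) := by
      rw [LinearMap.mem_ker]
      ext w
      have hw : w ∈ LinearMap.ker T ⊔ LinearMap.range T := htop ▸ Submodule.mem_top
      obtain ⟨y, hy, _, ⟨v, rfl⟩, rfl⟩ := Submodule.mem_sup.mp hw
      rw [LinearMap.mem_ker, hTa, sub_eq_zero] at hy
      have h1 := hxy ⟨y, Module.End.mem_eigenspace_iff.mpr (by simpa using hy)⟩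
      rw [map_add, LinearMap.zero_apply, hTa, map_sub]
      have h2 : killingForm ℂ L ⁅f, x⁆ y = 0 :=
        (LieModule.traceForm_apply_lie_apply ℂ L L f x y).trans h1
      have h3 : killingForm ℂ L ⁅f, x⁆ ⁅h, v⁆ = killingForm ℂ L ⁅f, x⁆ v := by
        have := LieModule.traceForm_apply_lie_apply ℂ L L ⁅f, x⁆ h v
        rw [← lie_skew, hfx, neg_neg] at this
        exact this.symm
      rw [h2, h3]; simp
    rwa [LieAlgebra.IsKilling.ker_killingForm_eq_bot, Submodule.mem_bot] at hker
  by_contra hne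
  have hne' : x ≠ 0 := fun h0 ↦ hne (Subtype.ext h0)
  have P : ht.symm.HasPrimitiveVectorWith x (-1 : ℂ) := ⟨hne', by rw [neg_lie, hx']; simp, hz⟩
  obtain ⟨n, hn⟩ := P.exists_nat
  have : ((n + 1 : ℕ) : ℂ) = 0 := by push_cast; rw [← hn]; ring
  exact Nat.succ_ne_zero n (Nat.cast_eq_zero.mp this)
end

section
/- Let (W, S) be a Coxeter system and let w ∈ W be fully commutative, i.e., no reduced word for w contains, as a consecutive subword, an alternating word s t s t … of length m(s,t) for a pair of non-commuting simple reflections s, t (where m(s,t) ≥ 3 is the order of st). Let S' ⊆ S be a set of simple reflections such that ℓ(w s) < ℓ(w) for every s ∈ S'. Then any two elements of S' commute: s t = t s for all s, t ∈ S'. -/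
namespace FCProof

open CoxeterSystem

variable {B W : Type*} [Group W] {M : CoxeterMatrix B} (cs : CoxeterSystem M W)

/-! ### Contragredient geometric representation -/

noncomputable def sig (M : CoxeterMatrix B) (i : B) : Function.End (B → ℝ) :=
  fun f k => f k + 2 * Real.cos (Real.pi / M i k) * f i

theorem sig_apply (i : B) (f : B → ℝ) (k : B) :
    sig M i f k = f k + 2 * Real.cos (Real.pi / M i k) * f i := rfl

theorem sig_self (i : B) (f : B → ℝ) : sig M i f i = - f i := by
  rw [sig_apply, M.diagonal]; simp; ring

theorem sig_sq (i : B) : sig M i * sig M i = 1 := by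
  funext f; funext k
  change sig M i (sig M i f) k = f k
  rw [sig_apply, sig_self, sig_apply]; ring

/-- the sequence solving `u (n+2) = C u (n+1) - u n`. -/
noncomputable def useq (C x y : ℝ) : ℕ → ℝ
  | 0 => -x
  | 1 => y
  | (n + 2) => C * useq C x y (n + 1) - useq C x y n

theorem sig_pow (i j : B) (f : B → ℝ) (n : ℕ) :
    ∃ X Y : ℝ, (∀ k, ((sig M i * sig M j) ^ n : Function.End (B → ℝ)) f k =
        f k + 2 * Real.cos (Real.pi / M i k) * X + 2 * Real.cos (Real.pi / M j k) * Y) ∧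
      ((sig M i * sig M j) ^ n : Function.End (B → ℝ)) f i
        = - useq (2 * Real.cos (Real.pi / M i j)) (f i) (f j) (2 * n) ∧
      ((sig M i * sig M j) ^ n : Function.End (B → ℝ)) f j
        = useq (2 * Real.cos (Real.pi / M i j)) (f i) (f j) (2 * n + 1) := by
  induction n with
  | zero => exact ⟨0, 0, fun k => by simp [Function.End.one_def], by simp [useq, Function.End.one_def],
      by simp [useq, Function.End.one_def]⟩
  | succ n ih =>
    obtain ⟨X, Y, h, hi, hj⟩ := ih
    set g := ((sig M i * sig M j) ^ n : Function.End (B → ℝ)) f with hg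
    have hs : ((sig M i * sig M j) ^ (n + 1) : Function.End (B → ℝ)) f
        = sig M i (sig M j g) := by
      rw [pow_succ']; rfl
    rw [hs]
    have e1 : sig M j g i = useq (2 * Real.cos (Real.pi / M i j)) (f i) (f j) (2 * n + 2) := by
      rw [sig_apply, hi, hj, useq, M.symmetric j i]; ring
    refine ⟨X + sig M j g i, Y + g j, fun k => ?_, ?_, ?_⟩
    · rw [sig_apply, sig_apply (i := j) (k := k), h]; ring
    · rw [sig_self, e1]; rfl
    · rw [sig_apply, e1, sig_self, hj]
      change _ = 2 * Real.cos (Real.pi / M i j) *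
        useq (2 * Real.cos (Real.pi / M i j)) (f i) (f j) (2 * n + 2) -
        useq (2 * Real.cos (Real.pi / M i j)) (f i) (f j) (2 * n + 1)
      ring

theorem useq_sin (θ x y : ℝ) (n : ℕ) :
    useq (2 * Real.cos θ) x y n * Real.sin θ
      = y * Real.sin (n * θ) + x * Real.sin (n * θ - θ) := by
  induction n using Nat.twoStepInduction with
  | zero => simp [useq]
  | one => simp [useq]
  | more n h1 h2 =>
    rw [useq, sub_mul, mul_assoc, h1, h2]
    have e1 : ((n + 1 + 1 : ℕ) : ℝ) * θ = n * θ + θ + θ := by push_cast; ring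
    have e2 : ((n + 1 : ℕ) : ℝ) * θ = n * θ + θ := by push_cast; ring
    simp only [e1, e2, add_sub_cancel_right]
    generalize (n : ℝ) * θ = a
    have hc := Real.sin_sq_add_cos_sq θ
    simp only [Real.sin_add, Real.cos_add, Real.sin_sub]
    grind

theorem useq_two (x y : ℝ) (n : ℕ) : useq 2 x y n = n * y + (n - 1) * x := by
  induction n using Nat.twoStepInduction with
  | zero => simp [useq]
  | one => simp [useq]
  | more n h1 h2 => rw [useq, h1, h2]; push_cast; ring

theorem sin_pos_of_two_le {m : ℕ} (hm : 2 ≤ m) : 0 < Real.sin (Real.pi / m) := by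
  have : (2 : ℝ) ≤ m := by exact_mod_cast hm
  apply Real.sin_pos_of_pos_of_lt_pi
  · positivity
  · rw [div_lt_iff₀ (by linarith)]; nlinarith [Real.pi_pos]

theorem sig_liftable : M.IsLiftable (sig M) := by
  intro i j
  by_cases h0 : M i j = 0
  · rw [h0, pow_zero]
  by_cases h1 : M i j = 1
  · have : i = j := by
      by_contra h; exact M.off_diagonal i j h h1
    subst this
    rw [sig_sq, one_pow]
  have hs := sin_pos_of_two_le (m := M i j) (by omega)
  funext f
  obtain ⟨X, Y, h, hi, hj⟩ := sig_pow (M := M) i j f (M i j)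
  have hu1 := useq_sin (Real.pi / M i j) (f i) (f j) (2 * M i j)
  have hu2 := useq_sin (Real.pi / M i j) (f i) (f j) (2 * M i j + 1)
  have hm : (M i j : ℝ) ≠ 0 := by exact_mod_cast h0
  have e1 : ((2 * M i j : ℕ) : ℝ) * (Real.pi / M i j) = 2 * Real.pi := by
    push_cast; field_simp
  have e2 : ((2 * M i j + 1 : ℕ) : ℝ) * (Real.pi / M i j) = Real.pi / M i j + 2 * Real.pi := by
    push_cast; field_simp; ring
  rw [e1] at hu1
  rw [e2] at hu2
  rw [Real.sin_two_pi, sub_eq_neg_add, Real.sin_add_two_pi, Real.sin_neg] at hu1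
  rw [Real.sin_add_two_pi, add_sub_cancel_left, Real.sin_two_pi] at hu2
  have k1 : useq (2 * Real.cos (Real.pi / M i j)) (f i) (f j) (2 * M i j) = - f i := by
    apply mul_right_cancel₀ hs.ne'; rw [hu1]; ring
  have k2 : useq (2 * Real.cos (Real.pi / M i j)) (f i) (f j) (2 * M i j + 1) = f j := by
    apply mul_right_cancel₀ hs.ne'; rw [hu2]; ring
  rw [k1] at hi
  rw [k2] at hj
  rw [h i, M.diagonal, M.symmetric j i] at hi
  rw [h j, M.diagonal] at hj
  simp only [Nat.cast_one, div_one, Real.cos_pi] at hi hj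
  have hc := Real.sin_sq_add_cos_sq (Real.pi / M i j)
  set c := Real.cos (Real.pi / M i j)
  set s := Real.sin (Real.pi / M i j)
  have a1 : X = c * Y := by linarith
  have a2 : Y = c * X := by linarith
  have hY : s ^ 2 * Y = 0 := by
    have : s ^ 2 = 1 - c ^ 2 := by linarith
    rw [this]; linear_combination a2 + c * a1
  have hY0 : Y = 0 := by
    rcases mul_eq_zero.1 hY with h | h
    · exact absurd h (pow_ne_zero 2 hs.ne')
    · exact h
  have hX0 : X = 0 := by rw [a1, hY0, mul_zero]
  funext k
  rw [h k, hX0, hY0]; simp [Function.End.one_def]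

/-- No smaller power of `s_i s_j` is trivial. -/
theorem pow_ne_one {i j : B} (h1 : M i j ≠ 1) {n : ℕ} (hn : 0 < n) (hM : M i j = 0 ∨ n < M i j) :
    (cs.simple i * cs.simple j) ^ n ≠ 1 := by
  classical
  intro h
  have hij : j ≠ i := by rintro rfl; exact h1 (M.diagonal j)
  have hσ : ((sig M i * sig M j) ^ n : Function.End (B → ℝ)) = 1 := by
    have := congrArg (cs.lift ⟨sig M, sig_liftable⟩) h
    rwa [map_pow, map_mul, cs.lift_apply_simple, cs.lift_apply_simple, map_one] at this
  set f : B → ℝ := Pi.single j 1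
  have fi : f i = 0 := by simp [f, hij.symm]
  have fj : f j = 1 := by simp [f]
  obtain ⟨-, -, -, hi, hj⟩ := sig_pow (M := M) i j f n
  rw [hσ, fi, fj] at hi hj
  simp only [Function.End.one_def, id, fi, fj] at hi hj
  by_cases h0 : M i j = 0
  · rw [h0] at hi
    simp [useq_two] at hi
    omega
  have hlt : n < M i j := by tauto
  have hs := sin_pos_of_two_le (m := M i j) (by omega)
  have hu1 := useq_sin (Real.pi / M i j) 0 1 (2 * n)
  have hu2 := useq_sin (Real.pi / M i j) 0 1 (2 * n + 1)
  rw [← hj] at hu2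
  have hi' : useq (2 * Real.cos (Real.pi / M i j)) 0 1 (2 * n) = 0 := by linarith
  rw [hi'] at hu1
  have e2 : ((2 * n + 1 : ℕ) : ℝ) * (Real.pi / M i j)
      = ((2 * n : ℕ) : ℝ) * (Real.pi / M i j) + Real.pi / M i j := by
    push_cast; ring
  rw [e2, Real.sin_add] at hu2
  simp only [zero_mul, one_mul, add_zero] at hu1 hu2
  rw [← hu1, zero_mul, zero_add] at hu2
  have hcos : Real.cos (((2 * n : ℕ) : ℝ) * (Real.pi / M i j)) = 1 := by
    apply mul_right_cancel₀ hs.ne'; rw [← hu2, one_mul]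
  have hmpos : (0 : ℝ) < M i j := by exact_mod_cast Nat.pos_of_ne_zero h0
  have hnpos : (0 : ℝ) < n := by exact_mod_cast hn
  have hlt' : (n : ℝ) < M i j := by exact_mod_cast hlt
  have hpos : 0 < ((2 * n : ℕ) : ℝ) * (Real.pi / M i j) := by push_cast; positivity
  have hlt2 : ((2 * n : ℕ) : ℝ) * (Real.pi / M i j) < 2 * Real.pi := by
    push_cast
    rw [mul_div_assoc', div_lt_iff₀ hmpos]
    nlinarith [Real.pi_pos]
  rw [Real.cos_eq_one_iff_of_lt_of_lt (by linarith [Real.pi_pos]) hlt2] at hcos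
  linarith

/-! ### The exchange property -/

open Classical in
noncomputable def eta (i : B) : Function.End (W × ZMod 2) :=
  fun p => (cs.simple i * p.1 * cs.simple i, p.2 + if p.1 = cs.simple i then 1 else 0)

open Classical in
theorem eta_pow (i j : B) (n : ℕ) (p : W × ZMod 2) :
    ((eta cs i * eta cs j) ^ n : Function.End (W × ZMod 2)) p =
      ((cs.simple i * cs.simple j) ^ n * p.1 * ((cs.simple i * cs.simple j) ^ n)⁻¹,
        p.2 + ∑ l ∈ Finset.range (2 * n),
          if p.1 = (cs.simple j * cs.simple i) ^ l * cs.simple j then 1 else 0) := by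
  induction n with
  | zero => simp [Function.End.one_def]
  | succ n ih =>
    have hs : ((eta cs i * eta cs j) ^ (n + 1) : Function.End (W × ZMod 2)) p
        = eta cs i (eta cs j (((eta cs i * eta cs j) ^ n : Function.End (W × ZMod 2)) p)) := by
      rw [pow_succ']; rfl
    have hinv : ((cs.simple i * cs.simple j) ^ n)⁻¹ = (cs.simple j * cs.simple i) ^ n := by
      rw [← inv_pow]; simp
    have hcomm : ∀ n : ℕ, cs.simple j * (cs.simple i * cs.simple j) ^ n
        = (cs.simple j * cs.simple i) ^ n * cs.simple j := by
      intro n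
      induction n with
      | zero => simp
      | succ n ih => rw [pow_succ, ← mul_assoc, ih, pow_succ]; simp only [mul_assoc]
    rw [hs, ih]
    have c1 : ((cs.simple i * cs.simple j) ^ n * p.1 * ((cs.simple i * cs.simple j) ^ n)⁻¹
          = cs.simple j) ↔ p.1 = (cs.simple j * cs.simple i) ^ (2 * n) * cs.simple j := by
      rw [mul_inv_eq_iff_eq_mul, ← eq_inv_mul_iff_mul_eq, hinv, hcomm, two_mul, pow_add, mul_assoc]
    have c2 : (cs.simple j * ((cs.simple i * cs.simple j) ^ n * p.1 *
          ((cs.simple i * cs.simple j) ^ n)⁻¹) * cs.simple j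
          = cs.simple i) ↔ p.1 = (cs.simple j * cs.simple i) ^ (2 * n + 1) * cs.simple j := by
      have : (cs.simple j * cs.simple i) ^ (2 * n + 1) * cs.simple j
        = (cs.simple j * cs.simple i) ^ n * (cs.simple j * cs.simple i * cs.simple j) *
          (cs.simple i * cs.simple j) ^ n := by
        rw [mul_assoc, mul_assoc (cs.simple j * cs.simple i) (cs.simple j), hcomm]
        rw [show 2 * n + 1 = n + (1 + n) by ring, pow_add, pow_add]
        simp only [mul_assoc, pow_one]
      rw [this, ← hinv]
      generalize (cs.simple i * cs.simple j) ^ n = g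
      have hj := cs.inv_simple j
      constructor
      · intro h
        rw [← h]; simp [mul_assoc]
      · intro h
        rw [h]; simp [mul_assoc]
    simp only [eta, c1, c2]
    rw [show 2 * (n + 1) = 2 * n + 1 + 1 by ring, Finset.sum_range_succ, Finset.sum_range_succ]
    refine Prod.ext ?_ ?_
    · simp [pow_succ', mul_assoc]
    · simp only [add_assoc]

theorem eta_liftable : M.IsLiftable (eta cs) := by
  classical
  intro i j
  funext p
  rw [eta_pow]
  simp only [two_mul, Finset.sum_range_add, pow_add, cs.simple_mul_simple_pow,
    cs.simple_mul_simple_pow', one_mul, inv_one, mul_one, CharTwo.add_self_eq_zero, add_zero]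
  rfl

noncomputable def etaHom : W →* Function.End (W × ZMod 2) := cs.lift ⟨eta cs, eta_liftable cs⟩

open Classical in
theorem etaHom_wordProd (ω : List B) (p : W × ZMod 2) :
    etaHom cs (cs.wordProd ω) p =
      (cs.wordProd ω * p.1 * (cs.wordProd ω)⁻¹, p.2 + ((cs.rightInvSeq ω).count p.1 : ZMod 2)) := by
  induction ω with
  | nil => simp [Function.End.one_def]
  | cons i ω ih =>
    rw [cs.wordProd_cons, map_mul]
    change etaHom cs (cs.simple i) (etaHom cs (cs.wordProd ω) p) = _
    rw [ih]
    have : etaHom cs (cs.simple i) = eta cs i := cs.lift_apply_simple (eta_liftable cs) i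
    rw [this, eta, rightInvSeq, List.count_cons]
    have c : (cs.wordProd ω * p.1 * (cs.wordProd ω)⁻¹ = cs.simple i) ↔
        ((cs.wordProd ω)⁻¹ * cs.simple i * cs.wordProd ω = p.1) := by
      constructor
      · intro h; rw [← h]; group
      · intro h; rw [← h]; group
    refine Prod.ext ?_ ?_
    · simp [mul_assoc]
    · simp only [c, beq_iff_eq]
      push_cast
      rw [add_assoc]

theorem mem_rightInvSeq {ω : List B} {i : B}
    (h : cs.length (cs.wordProd ω * cs.simple i) < cs.length (cs.wordProd ω)) :
    cs.simple i ∈ cs.rightInvSeq ω := by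
  classical
  obtain ⟨ω', hr, hw⟩ := cs.exists_isReduced (cs.wordProd ω * cs.simple i)
  have hp : cs.wordProd (ω'.concat i) = cs.wordProd ω := by
    rw [cs.wordProd_concat, ← hw]; simp
  have hred : cs.IsReduced (ω'.concat i) := by
    have h2 := (cs.isRightDescent_iff).1 h
    rw [CoxeterSystem.IsReduced, hp, ← h2, hw, hr.eq]; simp
  have hmem : cs.simple i ∈ cs.rightInvSeq (ω'.concat i) := by
    rw [rightInvSeq_concat]; simp
  have hcount : (cs.rightInvSeq (ω'.concat i)).count (cs.simple i) = 1 :=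
    List.count_eq_one_of_mem hred.nodup_rightInvSeq hmem
  have e1 := etaHom_wordProd cs (ω'.concat i) (cs.simple i, 0)
  rw [hp, etaHom_wordProd] at e1
  have e2 := congrArg Prod.snd e1
  simp only [hcount] at e2
  by_contra hn
  rw [List.count_eq_zero_of_not_mem hn] at e2
  simp at e2

theorem mem_rightInvSeq_alternatingWord (m : ℕ) : ∀ (i j : B) (t : W),
    t ∈ cs.rightInvSeq (alternatingWord i j m) →
    ∃ l < m, t = (cs.simple j * cs.simple i) ^ l * cs.simple j := by
  induction m with
  | zero => intro i j t h; simp [alternatingWord] at h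
  | succ m ih =>
    intro i j t h
    rw [alternatingWord_succ, rightInvSeq_concat] at h
    simp only [List.concat_eq_append, List.mem_append, List.mem_map, List.mem_singleton] at h
    rcases h with ⟨t', ht', rfl⟩ | rfl
    · obtain ⟨l, hl, rfl⟩ := ih j i t' ht'
      refine ⟨l + 1, by omega, ?_⟩
      have hcomm : cs.simple j * (cs.simple i * cs.simple j) ^ l
          = (cs.simple j * cs.simple i) ^ l * cs.simple j := by
        clear hl ht'
        induction l with
        | zero => simp
        | succ n ih => rw [pow_succ, ← mul_assoc, ih, pow_succ]; simp only [mul_assoc]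
      simp only [MulAut.conj_apply, cs.inv_simple]
      rw [← mul_assoc, hcomm, pow_succ]; simp only [mul_assoc]
    · exact ⟨0, by omega, by simp⟩

theorem key (w : W) (m : ℕ) : ∀ (i j : B), M i j ≠ 1 → (M i j = 0 ∨ m ≤ M i j) →
    cs.length (w * cs.simple i) < cs.length w → cs.length (w * cs.simple j) < cs.length w →
    ∃ ω : List B, cs.wordProd (ω ++ alternatingWord i j m) = w ∧
      cs.IsReduced (ω ++ alternatingWord i j m) := by
  induction m with
  | zero =>
    intro i j _ _ _ _
    obtain ⟨ω, h1, h2⟩ := cs.exists_isReduced w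
    exact ⟨ω, by simp [alternatingWord, h2], by simpa [alternatingWord] using h1⟩
  | succ m ih =>
    intro i j h1 hm hi hj
    have hsymm := M.symmetric i j
    obtain ⟨ω, hw, hr⟩ := ih j i (by rwa [← hsymm]) (by rw [← hsymm]; omega) hj hi
    have hmem : cs.simple j ∈ cs.rightInvSeq (ω ++ alternatingWord j i m) :=
      mem_rightInvSeq cs (by rwa [hw])
    obtain ⟨k, hk, hke⟩ := List.getElem_of_mem hmem
    by_cases hkl : k < ω.length
    · have hd := cs.wordProd_mul_getD_rightInvSeq (ω ++ alternatingWord j i m) k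
      rw [List.getD_eq_getElem _ _ hk, hke, hw, List.eraseIdx_append_of_lt_length hkl] at hd
      have hprod : cs.wordProd (ω.eraseIdx k ++ alternatingWord i j (m + 1)) = w := by
        rw [alternatingWord_succ, cs.wordProd_append, cs.wordProd_concat, ← mul_assoc,
          ← cs.wordProd_append, ← hd]
        simp
      refine ⟨ω.eraseIdx k, hprod, ?_⟩
      have hl := hr.eq
      rw [hw] at hl
      rw [CoxeterSystem.IsReduced, hprod, hl]
      simp only [List.length_append, length_alternatingWord, List.length_eraseIdx_of_lt hkl]
      omega
    · exfalso
      have hmem2 : cs.simple j ∈ cs.rightInvSeq (alternatingWord j i m) := by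
        have := cs.rightInvSeq_drop (ω ++ alternatingWord j i m) ω.length
        rw [List.drop_left] at this
        rw [this, List.mem_iff_getElem]
        refine ⟨k - ω.length, by simp at hk ⊢; omega, ?_⟩
        rw [List.getElem_drop]
        simp only [← hke]
        congr 1
        omega
      obtain ⟨l, hl, he⟩ := mem_rightInvSeq_alternatingWord cs m j i _ hmem2
      refine pow_ne_one cs h1 (n := l + 1) (by omega) (by omega) ?_
      have : (cs.simple i * cs.simple j) ^ l = cs.simple j * cs.simple i := by
        rw [he]
        rw [mul_assoc, cs.simple_mul_simple_self, mul_one, ← he]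
      rw [pow_succ, this]; simp [mul_assoc]

end FCProof


/-- Let `(W, S)` be a Coxeter system (with simple reflections indexed by `B` and Coxeter matrix
`M`), and let `w ∈ W` be fully commutative: no reduced word for `w` contains, as a consecutive
subword, an alternating word `s t s t ⋯` of length `M i j` for a pair of non-commuting simple
reflections (i.e. with `M i j ≥ 3`).  Let `T ⊆ B` index a set of simple reflections such that
`ℓ(w s) < ℓ(w)` for every `s` indexed by `T`.  Then any two simple reflections indexed by `T`
commute. -/
theorem fully_commutative_right_descents_commute
    {B W : Type*} [Group W] {M : CoxeterMatrix B} (cs : CoxeterSystem M W)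
    (w : W)
    (hfc : ∀ ω : List B, cs.wordProd ω = w → cs.IsReduced ω →
      ∀ i j : B, 3 ≤ M i j → ¬ (CoxeterSystem.alternatingWord i j (M i j) <:+: ω))
    (T : Set B)
    (hT : ∀ i ∈ T, cs.length (w * cs.simple i) < cs.length w) :
    ∀ i ∈ T, ∀ j ∈ T, cs.simple i * cs.simple j = cs.simple j * cs.simple i := by
  intro i hi j hj
  have h0 := hT i hi
  have h1 := hT j hj
  by_cases e1 : M i j = 1
  · have : i = j := by
      by_contra h; exact M.off_diagonal i j h e1
    rw [this]
  by_cases e2 : M i j = 2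
  · have h := cs.simple_mul_simple_pow i j
    rw [e2, pow_two, mul_eq_one_iff_eq_inv] at h
    simpa using h
  exfalso
  by_cases e0 : M i j = 0
  · obtain ⟨ω, hw, hr⟩ := FCProof.key cs w (cs.length w + 1) i j e1 (Or.inl e0) h0 h1
    have := hr.eq
    rw [hw] at this
    simp at this
    omega
  · obtain ⟨ω, hw, hr⟩ := FCProof.key cs w (M i j) i j e1 (Or.inr le_rfl) h0 h1
    exact hfc _ hw hr i j (by omega) (List.suffix_append _ _).isInfix
end
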